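/- Let S be a finite set of primes. The number of tuples (M_ℓ)_{ℓ∈S} ∈ ∏_{ℓ∈S} GL₂(𝔽_ℓ) such that no M_ℓ is special equals ∏_{ℓ∈S} ((ℓ²−1)(ℓ²−ℓ) − ℓ²); equivalently, the proportion of such tuples in ∏_{ℓ∈S} GL₂(𝔽_ℓ) is ∏_{ℓ∈S} (1 − ℓ/((ℓ−1)²(ℓ+1))). -/

import Mathlib

open Matrix
open scoped MatrixGroups

/-- A matrix in `GL₂` is *special* if it has determinant 1 and fixes a nonzero vector. -/
def Special {R : Type*} [CommRing R] (M : GL (Fin 2) R) : Prop :=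
  (M : Matrix (Fin 2) (Fin 2) R).det = 1 ∧
    ∃ v : Fin 2 → R, v ≠ 0 ∧ (M : Matrix (Fin 2) (Fin 2) R).mulVec v = v

theorem special_iff_det_eq_one_and_trace_eq_two {K : Type*} [Field K] (M : GL (Fin 2) K) :
    Special M ↔ (M : Matrix (Fin 2) (Fin 2) K).det = 1 ∧
      (M : Matrix (Fin 2) (Fin 2) K).trace = 2 := by
  refine and_congr_right fun hdet => ?_
  have hfix : (∃ v : Fin 2 → K, v ≠ 0 ∧ (M : Matrix (Fin 2) (Fin 2) K).mulVec v = v) ↔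
      ((M : Matrix (Fin 2) (Fin 2) K) - 1).det = 0 := by
    simp only [← Matrix.exists_mulVec_eq_zero_iff, Matrix.sub_mulVec, Matrix.one_mulVec, sub_eq_zero]
  rw [hfix]
  simp only [Matrix.det_fin_two, Matrix.trace_fin_two, Matrix.sub_apply, Matrix.one_apply_eq,
    Matrix.one_apply_ne zero_ne_one, Matrix.one_apply_ne one_ne_zero] at hdet ⊢
  constructor <;> intro h <;> linear_combination hdet - h

theorem card_special (K : Type*) [Field K] :
    Nat.card {M : GL (Fin 2) K // Special M} = Nat.card K ^ 2 := by
  classical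
  let e : {M : GL (Fin 2) K // Special M} → K × K := fun M =>
    (if M.1 1 0 = 0 then M.1 0 1 else M.1 0 0 - 1, M.1 1 0)
  have he : Function.Bijective e := by
    constructor
    · rintro ⟨M, hM⟩ ⟨N, hN⟩ h
      rw [special_iff_det_eq_one_and_trace_eq_two, Matrix.det_fin_two,
        Matrix.trace_fin_two] at hM hN
      obtain ⟨hdM, htM⟩ := hM
      obtain ⟨hdN, htN⟩ := hN
      obtain ⟨h₁, hc⟩ := Prod.ext_iff.mp h
      simp only [e] at h₁ hc
      have ha : M 0 0 = N 0 0 := by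
        by_cases hz : M 1 0 = 0
        · have hz' : N 1 0 = 0 := hc ▸ hz
          have hM1 : M 0 0 - 1 = 0 := by
            apply pow_eq_zero_iff two_ne_zero |>.mp
            linear_combination M 0 0 * htM - hdM - M 0 1 * hz
          have hN1 : N 0 0 - 1 = 0 := by
            apply pow_eq_zero_iff two_ne_zero |>.mp
            linear_combination N 0 0 * htN - hdN - N 0 1 * hz'
          linear_combination hM1 - hN1
        · rw [if_neg hz, if_neg (hc ▸ hz)] at h₁
          linear_combination h₁
      have hd : M 1 1 = N 1 1 := by linear_combination htM - htN - ha
      have hb : M 0 1 = N 0 1 := by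
        by_cases hz : M 1 0 = 0
        · rwa [if_pos hz, if_pos (hc ▸ hz)] at h₁
        · apply mul_right_cancel₀ hz
          linear_combination hdN - hdM + M 1 1 * ha + N 0 0 * hd - N 0 1 * hc
      apply Subtype.ext
      ext i j
      fin_cases i <;> fin_cases j <;> assumption
    · rintro ⟨x, c⟩
      let A : Matrix (Fin 2) (Fin 2) K :=
        if c = 0 then !![1, x; 0, 1] else !![1 + x, -x ^ 2 / c; c, 1 - x]
      have hA : A.det = 1 := by
        by_cases hc : c = 0
        · simp [A, hc, Matrix.det_fin_two]
        · simp only [A, if_neg hc, Matrix.det_fin_two_of]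
          field_simp
          ring
      have htr : A.trace = 2 := by
        by_cases hc : c = 0
        · simp [A, hc, Matrix.trace_fin_two, one_add_one_eq_two]
        · simp only [A, if_neg hc, Matrix.trace_fin_two_of]
          ring
      refine ⟨⟨Matrix.GeneralLinearGroup.mkOfDetNeZero A (hA ▸ one_ne_zero),
        (special_iff_det_eq_one_and_trace_eq_two _).mpr ⟨hA, htr⟩⟩, ?_⟩
      by_cases hc : c = 0 <;>
        simp [e, A, hc, Matrix.GeneralLinearGroup.mkOfDetNeZero]
  rw [Nat.card_congr (Equiv.ofBijective e he), Nat.card_prod, sq]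

theorem card_GL_fin_two (K : Type*) [Field K] [Finite K] :
    Nat.card (GL (Fin 2) K) = (Nat.card K ^ 2 - 1) * (Nat.card K ^ 2 - Nat.card K) := by
  have := Fintype.ofFinite K
  simp [Matrix.card_GL_field, Fin.prod_univ_two]

theorem card_not_special_add_sq (K : Type*) [Field K] [Finite K] :
    Nat.card {M : GL (Fin 2) K // ¬ Special M} + Nat.card K ^ 2 =
      (Nat.card K ^ 2 - 1) * (Nat.card K ^ 2 - Nat.card K) := by
  classical
  rw [← card_GL_fin_two, ← card_special, add_comm, ← Nat.card_sum]
  exact Nat.card_congr (Equiv.sumCompl Special)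

theorem card_not_special_div_card (K : Type*) [Field K] [Finite K] :
    (Nat.card {M : GL (Fin 2) K // ¬ Special M} : ℚ) / Nat.card (GL (Fin 2) K) =
      1 - (Nat.card K : ℚ) / (((Nat.card K : ℚ) - 1) ^ 2 * ((Nat.card K : ℚ) + 1)) := by
  have h := card_not_special_add_sq K
  rw [card_GL_fin_two]
  have hq : 1 < Nat.card K := Finite.one_lt_card
  set q := Nat.card K
  have hcast : (((q ^ 2 - 1) * (q ^ 2 - q) : ℕ) : ℚ) = (q ^ 2 - 1) * (q ^ 2 - q) := by
    rw [Nat.cast_mul, Nat.cast_sub (Nat.one_le_pow _ _ (by lia)),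
      Nat.cast_sub (Nat.le_self_pow two_ne_zero q)]
    push_cast
    rfl
  have h' : (Nat.card {M : GL (Fin 2) K // ¬ Special M} : ℚ) =
      (q ^ 2 - 1) * (q ^ 2 - q) - q ^ 2 := by
    rw [eq_sub_iff_add_eq, ← hcast, ← h]
    push_cast
    rfl
  have hq' : (1 : ℚ) < q := by exact_mod_cast hq
  have h₀ : (q : ℚ) ≠ 0 := by positivity
  have h₁ : (q : ℚ) - 1 ≠ 0 := by linarith
  have h₂ : (q : ℚ) + 1 ≠ 0 := by positivity
  rw [h', hcast, show ((q : ℚ) ^ 2 - 1) * (q ^ 2 - q) = q * ((q - 1) ^ 2 * (q + 1)) by ring]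
  field_simp

/-- Let `S` be a finite set of primes. The number of tuples
`(M_ℓ)_{ℓ∈S} ∈ ∏_{ℓ∈S} GL₂(𝔽_ℓ)` with no special component is
`∏_{ℓ∈S} ((ℓ²−1)(ℓ²−ℓ) − ℓ²)`; equivalently the proportion of such tuples is
`∏_{ℓ∈S} (1 − ℓ/((ℓ−1)²(ℓ+1)))`. -/
theorem card_tuples_not_special (S : Finset ℕ) (hS : ∀ ℓ ∈ S, ℓ.Prime) :
    Nat.card {f : (ℓ : S) → GL (Fin 2) (ZMod ℓ) // ∀ ℓ, ¬ Special (f ℓ)} =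
      ∏ ℓ ∈ S, ((ℓ ^ 2 - 1) * (ℓ ^ 2 - ℓ) - ℓ ^ 2) ∧
    ((Nat.card {f : (ℓ : S) → GL (Fin 2) (ZMod ℓ) // ∀ ℓ, ¬ Special (f ℓ)} : ℚ) /
        (Nat.card ((ℓ : S) → GL (Fin 2) (ZMod ℓ)) : ℚ) =
      ∏ ℓ ∈ S, (1 - (ℓ : ℚ) / (((ℓ : ℚ) - 1) ^ 2 * ((ℓ : ℚ) + 1)))) := by
  have hcard : Nat.card {f : (ℓ : S) → GL (Fin 2) (ZMod ℓ) // ∀ ℓ, ¬ Special (f ℓ)} =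
      ∏ ℓ : S, Nat.card {M : GL (Fin 2) (ZMod ℓ) // ¬ Special M} := by
    rw [Nat.card_congr (Equiv.subtypePiEquivPi (p := fun _ M => ¬ Special M)), Nat.card_pi]
  constructor
  · rw [hcard, ← Finset.prod_coe_sort S]
    refine Finset.prod_congr rfl fun ℓ _ => ?_
    have : Fact (ℓ : ℕ).Prime := ⟨hS ℓ ℓ.2⟩
    have h := card_not_special_add_sq (ZMod ℓ)
    rw [Nat.card_zmod] at h
    exact Nat.eq_sub_of_add_eq h
  · rw [hcard, Nat.card_pi, ← Finset.prod_coe_sort S, Nat.cast_prod, Nat.cast_prod,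
      ← Finset.prod_div_distrib]
    refine Finset.prod_congr rfl fun ℓ _ => ?_
    have : Fact (ℓ : ℕ).Prime := ⟨hS ℓ ℓ.2⟩
    simpa only [Nat.card_zmod] using card_not_special_div_card (ZMod ℓ)
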